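/- arXiv:2010.07908 — 2 statements merged into one kernel-verified Lean document; each statement's English description precedes it below -/
import Mathlib

section
/- Let H and D be complex Hilbert spaces, U a unitary operator on H, B : D → H a linear isometry, Γ a contraction on D, and T := U + B(Γ − I)B*U (so T is a contraction). Then the defect operators satisfy D_T = U*B D_Γ B*U and D_{T*} = B D_{Γ*} B*, i.e. (I − T*T)^{1/2} = U*B(I − Γ*Γ)^{1/2}B*U and (I − TT*)^{1/2} = B(I − ΓΓ*)^{1/2}B*. -/
set_option synthInstance.maxHeartbeats 1000000

open ContinuousLinearMap

/-- Equation (A.3) for the defect operators: for the contraction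
`T = U + B (Γ - I) B* U` (with `U` unitary, `B` an isometry, `Γ` a contraction),
`D_T = (I - T*T)^{1/2} = U* B (I - Γ*Γ)^{1/2} B* U` and
`D_{T*} = (I - TT*)^{1/2} = B (I - ΓΓ*)^{1/2} B*`. -/
theorem defect_operator_identities
    {H D : Type*} [NormedAddCommGroup H] [InnerProductSpace ℂ H] [CompleteSpace H]
    [NormedAddCommGroup D] [InnerProductSpace ℂ D] [CompleteSpace D]
    (U : H →L[ℂ] H) (hU : U ∈ unitary (H →L[ℂ] H))
    (B : D →L[ℂ] H) (hB : ∀ x : D, ‖B x‖ = ‖x‖)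
    (Γ : D →L[ℂ] D) (hΓ : ‖Γ‖ ≤ 1)
    (T : H →L[ℂ] H) (hT : T = U + B ∘L (Γ - 1) ∘L adjoint B ∘L U) :
    CFC.sqrt (1 - star T * T) =
        adjoint U ∘L B ∘L CFC.sqrt (1 - star Γ * Γ) ∘L adjoint B ∘L U ∧
      CFC.sqrt (1 - T * star T) =
        B ∘L CFC.sqrt (1 - Γ * star Γ) ∘L adjoint B := by
  have hBB : ∀ x, adjoint B (B x) = x := by
    intro x
    have h := (ContinuousLinearMap.norm_map_iff_adjoint_comp_self B).1 hB
    simpa using congrArg (fun f : D →L[ℂ] D => f x) h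
  have hUU : ∀ x, adjoint U (U x) = x := by
    intro x
    have h := (Unitary.mem_iff.1 hU).1
    simpa [star_eq_adjoint] using congrArg (fun f : H →L[ℂ] H => f x) h
  have hUU' : ∀ x, U (adjoint U x) = x := by
    intro x
    have h := (Unitary.mem_iff.1 hU).2
    simpa [star_eq_adjoint] using congrArg (fun f : H →L[ℂ] H => f x) h
  have hTx : ∀ x, T x = U x + B (Γ (adjoint B (U x)) - adjoint B (U x)) := by
    intro x; rw [hT]; simp
  have hTa : ∀ x, adjoint T x =
      adjoint U (x + B (adjoint Γ (adjoint B x) - adjoint B x)) := by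
    intro x
    have h1 : adjoint (1 : D →L[ℂ] D) = 1 := by
      rw [← star_eq_adjoint, star_one]
    rw [hT]
    simp only [map_add, map_sub, adjoint_comp, adjoint_adjoint, h1, add_apply, comp_apply,
      sub_apply, one_apply_eq_self]
  have key : ∀ G : D →L[ℂ] D, ‖G‖ ≤ 1 → 0 ≤ 1 - star G * G := by
    intro G hG
    rw [sub_nonneg, ← CStarAlgebra.norm_le_one_iff_of_nonneg _ (star_mul_self_nonneg G),
      CStarRing.norm_star_mul_self]
    nlinarith [norm_nonneg G]
  have k1 := key Γ hΓ
  have k2 : 0 ≤ 1 - Γ * star Γ := by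
    simpa using key (star Γ) (by rwa [norm_star])
  have s1 : ∀ x, CFC.sqrt (1 - star Γ * Γ) (CFC.sqrt (1 - star Γ * Γ) x)
      = x - adjoint Γ (Γ x) := by
    intro x
    simpa [star_eq_adjoint] using
      congrArg (fun f : D →L[ℂ] D => f x) (CFC.sqrt_mul_sqrt_self _ k1)
  have s2 : ∀ x, CFC.sqrt (1 - Γ * star Γ) (CFC.sqrt (1 - Γ * star Γ) x)
      = x - Γ (adjoint Γ x) := by
    intro x
    simpa [star_eq_adjoint] using
      congrArg (fun f : D →L[ℂ] D => f x) (CFC.sqrt_mul_sqrt_self _ k2)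
  have p1 := (nonneg_iff_isPositive _).1 (CFC.sqrt_nonneg (1 - star Γ * Γ))
  have p2 := (nonneg_iff_isPositive _).1 (CFC.sqrt_nonneg (1 - Γ * star Γ))
  simp only [star_eq_adjoint] at s1 s2
  constructor
  · refine CFC.sqrt_unique ?_ ?_
    · ext x
      simp only [mul_apply_eq_comp, comp_apply, hUU', hBB, s1, sub_apply, one_apply_eq_self,
        star_eq_adjoint, hTx, hTa, map_add, map_sub, hUU]
      abel
    · rw [nonneg_iff_isPositive]
      exact (p1.conj_adjoint B).adjoint_conj U
  · refine CFC.sqrt_unique ?_ ?_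
    · ext x
      simp only [mul_apply_eq_comp, comp_apply, hUU', hBB, s2, sub_apply, one_apply_eq_self,
        star_eq_adjoint, hTx, hTa, map_add, map_sub]
      abel
    · rw [nonneg_iff_isPositive]
      exact p2.conj_adjoint B
end

section
/- Let H and D be complex Hilbert spaces, U a unitary operator on H, B : D → H a linear isometry, Γ a self-adjoint strict contraction on D with Γ ≥ 0, and T := U + B(Γ − I)B*U (a contraction). Define β := (I − Γ)^{1/2}(I + Γ)^{−1/2} (a bounded self-adjoint operator, since I + Γ is positive and invertible), F₂(z) := B*(I + zU*)(I − zU*)⁻¹B, and θ(z) := B*(−T + zD_{T*}(I − zT*)⁻¹D_T)U*B for z in the open unit disc 𝔻. Then for every z ∈ 𝔻 the operator βF₂(z)β + I is invertible and θ(z) = (βF₂(z)β − I)(βF₂(z)β + I)⁻¹. -/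
set_option synthInstance.maxHeartbeats 1000000
set_option maxHeartbeats 2000000

open ContinuousLinearMap


lemma aux_alg {R : Type*} [Ring R] [Algebra ℂ R] (Γ s t ti M N : R)
    (hs : s * s = 1 - Γ) (ht : t * t = 1 + Γ) (hst : s * t = t * s)
    (h1 : t * ti = 1) (h2 : ti * t = 1)
    (hMN : M = N + M * (1 - Γ) * N) (hNM : M = N + N * (1 - Γ) * M) :
    IsUnit (s * ti * (1 + 2 * M) * (s * ti) + 1) ∧
    -Γ + s * t * N * (s * t) = (s * ti * (1 + 2 * M) * (s * ti) - 1) *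
      Ring.inverse (s * ti * (1 + 2 * M) * (s * ti) + 1) := by
  have hsti : s * ti = ti * s := by
    calc s * ti = (ti * t) * s * ti := by rw [h2, one_mul]
      _ = ti * (t * s) * ti := by noncomm_ring
      _ = ti * s * (t * ti) := by rw [← hst]; noncomm_ring
      _ = ti * s := by rw [h1, mul_one]
  have hti : ti * (t * t) * ti = 1 := by
    rw [← mul_assoc, h2, one_mul, h1]
  have e1 : (1 + s * M * s) * (1 - s * N * s) = 1 := by
    have : (1 + s * M * s) * (1 - s * N * s) = 1 + s * (M - (N + M * (s * s) * N)) * s := by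
      noncomm_ring
    rw [this, hs, ← hMN]; simp
  have e2 : (1 - s * N * s) * (1 + s * M * s) = 1 := by
    have : (1 - s * N * s) * (1 + s * M * s) = 1 + s * (M - (N + N * (s * s) * M)) * s := by
      noncomm_ring
    rw [this, hs, ← hNM]; simp
  set X := ti * (1 + s * M * s) * ti with hX
  set Y := t * (1 - s * N * s) * t with hY
  have hE : s * ti * (1 + 2 * M) * (s * ti) + 1 = (2 : ℂ) • X := by
    have a1 : s * ti * (1 + 2 * M) * (s * ti) + 1
        = ti * (s * s + 2 * (s * M * s)) * ti + ti * (t * t) * ti := by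
      rw [hti]
      have : s * ti * (1 + 2 * M) * (s * ti) = (ti * s) * (1 + 2 * M) * (s * ti) := by
        rw [← hsti]
      rw [this]; noncomm_ring
    rw [a1, hs, ht, two_smul, hX]; noncomm_ring
  have hXY : X * Y = 1 := by
    calc X * Y = ti * ((1 + s * M * s) * (ti * t) * (1 - s * N * s)) * t := by
          rw [hX, hY]; simp only [mul_assoc]
      _ = 1 := by rw [h2, mul_one, e1, mul_one, h2]
  have hYX : Y * X = 1 := by
    calc Y * X = t * ((1 - s * N * s) * (t * ti) * (1 + s * M * s)) * ti := by
          rw [hX, hY]; simp only [mul_assoc]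
      _ = 1 := by rw [h1, mul_one, e2, mul_one, h1]
  let u : Rˣ := ⟨(2 : ℂ) • X, (2⁻¹ : ℂ) • Y, by simp [smul_smul, hXY], by simp [smul_smul, hYX]⟩
  have hm : s * ti * (1 + 2 * M) * (s * ti) - 1 = (2 : ℂ) • X - 2 := by
    rw [eq_sub_of_add_eq hE, sub_sub, one_add_one_eq_two]
  have hu : ((2 : ℂ) • X) = (u : R) := rfl
  rw [hm, hE]
  refine ⟨⟨u, rfl⟩, ?_⟩
  rw [hu, Ring.inverse_unit, ← hu]
  change _ = ((2 : ℂ) • X - 2) * ((2⁻¹ : ℂ) • Y)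
  have : ((2 : ℂ) • X - 2) * ((2⁻¹ : ℂ) • Y) = 1 - Y := by
    rw [sub_mul, smul_mul_smul_comm, hXY, mul_smul_comm, two_mul Y, ← two_smul ℂ Y, smul_smul]
    norm_num
  rw [this, hY]
  have : 1 - t * (1 - s * N * s) * t = 1 - t * t + (t * s) * N * (s * t) := by noncomm_ring
  rw [this, ht, ← hst]; noncomm_ring

lemma aux_res {R : Type*} [Ring R] (W Q a r : R)
    (ha1 : a * (1 - W * (1 - Q)) = 1) (ha2 : (1 - W * (1 - Q)) * a = 1)
    (hr1 : r * (1 - W) = 1) (hr2 : (1 - W) * r = 1) :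
    r * W = a * W + r * W * Q * a * W ∧ r * W = a * W + a * W * Q * r * W ∧
      (1 + W) * r = 1 + 2 * (r * W) := by
  refine ⟨?_, ?_, ?_⟩
  · have : r * W = r * (((1 - W * (1 - Q)) * a) * W) := by rw [ha2, one_mul]
    have h3 : r * (((1 - W * (1 - Q)) * a) * W) = r * (1 - W) * a * W + r * W * Q * a * W := by
      noncomm_ring
    rw [h3, hr1, one_mul] at this
    exact this
  · have : r * W = (a * (1 - W * (1 - Q))) * r * W := by rw [ha1, one_mul]
    have h3 : (a * (1 - W * (1 - Q))) * r * W = a * ((1 - W) * r) * W + a * W * Q * r * W := by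
      noncomm_ring
    rw [h3, hr2, mul_one] at this
    exact this
  · have h1 : r - r * W = 1 := by rw [← hr1]; noncomm_ring
    have h2 : r - W * r = 1 := by rw [← hr2]; noncomm_ring
    have h3 : W * r = r * W := by
      rw [← h1] at h2; exact sub_right_inj.mp h2
    rw [add_mul, one_mul, h3, two_mul, ← add_assoc, ← h1]; noncomm_ring

lemma aux_sqrt_comm {A : Type*} [NormedAddCommGroup A] [InnerProductSpace ℂ A] [CompleteSpace A]
    (a b : A →L[ℂ] A) (h : Commute a b) : Commute (CFC.sqrt a) (CFC.sqrt b) :=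
  (h.cfcₙ_nnreal _).symm.cfcₙ_nnreal _ |>.symm

/-- Equation (3.4): for the contraction `T = U + B (Γ - I) B* U` with `U` unitary, `B` an
isometry and `Γ = Γ* ≥ 0` a strict contraction, with `β = (I - Γ)^{1/2} (I + Γ)^{-1/2}`,
`F₂(z) = B* (I + zU*)(I - zU*)⁻¹ B`, and the characteristic function
`θ(z) = B* (-T + z D_{T*} (I - z T*)⁻¹ D_T) U* B`, the operator `β F₂(z) β + I` is
invertible and `θ(z) = (β F₂(z) β - I)(β F₂(z) β + I)⁻¹` for `z` in the open unit disc. -/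
theorem characteristic_function_cayley
    {H D : Type*} [NormedAddCommGroup H] [InnerProductSpace ℂ H] [CompleteSpace H]
    [NormedAddCommGroup D] [InnerProductSpace ℂ D] [CompleteSpace D]
    (U : H →L[ℂ] H) (hU : U ∈ unitary (H →L[ℂ] H))
    (B : D →L[ℂ] H) (hB : ∀ x : D, ‖B x‖ = ‖x‖)
    (Γ : D →L[ℂ] D) (hΓsa : IsSelfAdjoint Γ) (hΓpos : (0 : D →L[ℂ] D) ≤ Γ)
    (hΓ : ∀ x : D, x ≠ 0 → ‖Γ x‖ < ‖x‖)
    (T : H →L[ℂ] H) (hT : T = U + B ∘L (Γ - 1) ∘L adjoint B ∘L U)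
    (β : D →L[ℂ] D) (hβ : β = CFC.sqrt (1 - Γ) * Ring.inverse (CFC.sqrt (1 + Γ)))
    (z : ℂ) (hz : ‖z‖ < 1)
    (F₂ : D →L[ℂ] D)
    (hF₂ : F₂ = adjoint B ∘L ((1 + z • adjoint U) * Ring.inverse (1 - z • adjoint U)) ∘L B)
    (θ : D →L[ℂ] D)
    (hθ : θ = adjoint B ∘L
        (-T + z • (CFC.sqrt (1 - T * star T) ∘L Ring.inverse (1 - z • adjoint T) ∘L
          CFC.sqrt (1 - star T * T))) ∘L adjoint U ∘L B) :
    IsUnit (β * F₂ * β + 1) ∧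
      θ = (β * F₂ * β - 1) * Ring.inverse (β * F₂ * β + 1) := by
  have hCB : adjoint B ∘L B = 1 := (norm_map_iff_adjoint_comp_self B).mp hB
  have hCBx : ∀ x, adjoint B (B x) = x := fun x => DFunLike.congr_fun hCB x
  have hUU : star U * U = 1 := (Unitary.mem_iff.mp hU).1
  have hUU' : U * star U = 1 := (Unitary.mem_iff.mp hU).2
  -- square roots on D
  have hΓ1 : Γ ≤ 1 := by
    have hn : ‖Γ‖ ≤ 1 := by
      refine opNorm_le_bound _ zero_le_one fun x => ?_
      rw [one_mul]
      by_cases hx : x = 0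
      · simp [hx]
      · exact (hΓ x hx).le
    exact (CStarAlgebra.norm_le_one_iff_of_nonneg Γ hΓpos).mp hn
  have hm : 0 ≤ 1 - Γ := sub_nonneg.mpr hΓ1
  have hp1 : (1 : D →L[ℂ] D) ≤ 1 + Γ := le_add_of_nonneg_right hΓpos
  have hp : 0 ≤ 1 + Γ := zero_le_one.trans hp1
  have hunit : IsUnit (1 + Γ) := CStarAlgebra.isUnit_of_le 1 hp1
  set s := CFC.sqrt (1 - Γ) with hsdef
  set t := CFC.sqrt (1 + Γ) with htdef
  have hs : s * s = 1 - Γ := CFC.sqrt_mul_sqrt_self _ hm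
  have ht : t * t = 1 + Γ := CFC.sqrt_mul_sqrt_self _ hp
  have hst : Commute s t := by
    apply aux_sqrt_comm
    show _ = _
    noncomm_ring
  have htu : IsUnit t := (CFC.isUnit_sqrt_iff _ hp).mpr hunit
  set ti := Ring.inverse t with hti
  have h1 : t * ti = 1 := Ring.mul_inverse_cancel _ htu
  have h2 : ti * t = 1 := Ring.inverse_mul_cancel _ htu
  have hs0 : 0 ≤ s := CFC.sqrt_nonneg _
  have ht0 : 0 ≤ t := CFC.sqrt_nonneg _
  set Δ := s * t with hΔ
  have hΔ0 : 0 ≤ Δ := Commute.mul_nonneg hs0 ht0 hst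
  have hΔsq : Δ * Δ = 1 - Γ * Γ := by
    calc Δ * Δ = s * (t * s) * t := by rw [hΔ]; noncomm_ring
      _ = (s * s) * (t * t) := by rw [← hst.eq]; noncomm_ring
      _ = 1 - Γ * Γ := by rw [hs, ht]; noncomm_ring
  have hΔx : ∀ x, Δ (Δ x) = x - Γ (Γ x) := fun x => DFunLike.congr_fun hΔsq x
  -- operators on H
  set Q : H →L[ℂ] H := B ∘L (1 - Γ) ∘L adjoint B with hQ
  have hTG : T = (1 - Q) * U := by
    rw [hT, hQ]; ext x
    simp [sub_eq_add_neg, add_comm]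
  have hQsa : star Q = Q := by
    have : IsSelfAdjoint (1 - Γ) := (IsSelfAdjoint.one _).sub hΓsa
    exact (this.conj_adjoint B)
  have hTs : star T = star U * (1 - Q) := by
    rw [hTG, star_mul, star_sub, star_one, hQsa]
  set X : H →L[ℂ] H := B ∘L Δ ∘L adjoint B with hX
  have hX0 : 0 ≤ X := by
    rw [nonneg_iff_isPositive] at hΔ0 ⊢
    exact hΔ0.conj_adjoint B
  have hXX : X * X = 1 - (1 - Q) * (1 - Q) := by
    ext x
    simp [hX, hQ, hCBx, hΔx]
    abel
  have hTT : X * X = 1 - T * star T := by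
    rw [hTs, hTG, hXX]
    have : (1 - Q) * U * (star U * (1 - Q)) = (1 - Q) * (U * star U) * (1 - Q) := by noncomm_ring
    rw [this, hUU', mul_one]
  have hTT' : (star U * X * U) * (star U * X * U) = 1 - star T * T := by
    have : (star U * X * U) * (star U * X * U) = star U * X * (U * star U) * X * U := by
      noncomm_ring
    rw [this, hUU', mul_one, mul_assoc (star U), hXX, hTs, hTG, mul_sub, sub_mul, mul_one, hUU]
    noncomm_ring
  have hs1 : CFC.sqrt (1 - T * star T) = X := CFC.sqrt_unique hTT hX0
  have hs2 : CFC.sqrt (1 - star T * T) = star U * X * U :=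
    CFC.sqrt_unique hTT' (star_left_conjugate_nonneg hX0 U)
  have hXsa : star X = X := (IsSelfAdjoint.of_nonneg hX0)
  have hTn : ‖T‖ ≤ 1 := by
    have h0 : T * star T ≤ 1 := by
      rw [← sub_nonneg, ← hTT]
      nth_rewrite 1 [← hXsa]
      exact star_mul_self_nonneg X
    have h3 := (CStarAlgebra.norm_le_one_iff_of_nonneg _ (mul_star_self_nonneg T)).mpr h0
    rw [CStarRing.norm_self_mul_star] at h3
    nlinarith [norm_nonneg T]
  have hUn : ‖star U‖ ≤ 1 := by
    rw [norm_star]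
    exact opNorm_le_bound _ zero_le_one fun x => by
      rw [one_mul]; exact (norm_map_of_mem_unitary hU x).le
  have hunitgen : ∀ S : H →L[ℂ] H, ‖S‖ ≤ 1 → IsUnit (1 - z • S) := by
    intro S hS
    apply isUnit_one_sub_of_norm_lt_one
    rw [norm_smul]
    nlinarith [norm_nonneg z, norm_nonneg S]
  have hu1 := hunitgen _ hUn
  have hu2 := hunitgen (star T) (by rwa [norm_star])
  rw [← star_eq_adjoint, hs1, hs2] at hθ
  rw [← star_eq_adjoint] at hF₂
  set W := z • star U with hW
  have hA : 1 - z • star T = 1 - W * (1 - Q) := by rw [hTs, hW, smul_mul_assoc]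
  rw [← star_eq_adjoint, hA] at hθ
  rw [hA] at hu2
  set a := Ring.inverse (1 - W * (1 - Q)) with ha
  set r := Ring.inverse (1 - W) with hr
  obtain ⟨k1, k2, k3⟩ := aux_res W Q a r (Ring.inverse_mul_cancel _ hu2)
    (Ring.mul_inverse_cancel _ hu2) (Ring.inverse_mul_cancel _ hu1)
    (Ring.mul_inverse_cancel _ hu1)
  set M : D →L[ℂ] D := adjoint B ∘L (r * W) ∘L B with hM
  set N : D →L[ℂ] D := adjoint B ∘L (a * W) ∘L B with hN
  have hMN : M = N + M * (1 - Γ) * N := by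
    ext x
    have := congrArg (adjoint B) (DFunLike.congr_fun k1 (B x))
    exact this.trans (map_add _ _ _)
  have hNM : M = N + N * (1 - Γ) * M := by
    ext x
    have := congrArg (adjoint B) (DFunLike.congr_fun k2 (B x))
    exact this.trans (map_add _ _ _)
  have hF : F₂ = 1 + 2 * M := by
    rw [hF₂, k3, two_mul, two_mul, hM]
    ext x
    simp [hCBx]
  have hUx : ∀ x, U (star U x) = x := fun x => DFunLike.congr_fun hUU' x
  have hth : θ = -Γ + s * t * N * (s * t) := by
    rw [hθ, ← hΔ, hTG, hN]
    ext x
    simp [hCBx, hUx, hX, hQ, hW]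
  rw [hth, hβ, hF]
  exact aux_alg Γ s t ti M N hs ht hst.eq h1 h2 hMN hNM
end
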